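/- Under the assumptions of the previous bound, if ∑_{N=l}^∞ [p^{Nn} ∑_{j=N+1}^∞ p^{jn}A_j]^{−1} = ∞ for some l ≥ 0, then ∫_{‖ξ‖ ≤ p^{−l}} (1 − â(ξ))^{−1} d^n ξ = ∞. -/

import Mathlib

open MeasureTheory
open scoped ENNReal

/-- The `p`-adic fractional part `{x}_p`. -/
noncomputable def pFract (p : ℕ) [Fact p.Prime] (x : ℚ_[p]) : ℚ :=
  Classical.epsilon fun r : ℚ =>
    0 ≤ r ∧ r < 1 ∧ (∃ m k : ℕ, r = (m : ℚ) / (p : ℚ) ^ k) ∧ ‖x - (r : ℚ_[p])‖ ≤ 1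

/-- The standard additive character `χ(x) = exp(2πi {x}_p)` of `ℚ_p`. -/
noncomputable def padicChar (p : ℕ) [Fact p.Prime] (x : ℚ_[p]) : ℂ :=
  Complex.exp (2 * Real.pi * Complex.I * ((pFract p x : ℚ) : ℂ))

lemma pFract_congr (p : ℕ) [Fact p.Prime] (x y : ℚ_[p]) (h : ‖y - x‖ ≤ 1) :
    pFract p y = pFract p x := by
  unfold pFract
  congr 1
  funext r
  have key : ‖y - (r : ℚ_[p])‖ ≤ 1 ↔ ‖x - (r : ℚ_[p])‖ ≤ 1 := by
    constructor
    · intro h1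
      have : x - (r : ℚ_[p]) = (y - r) + -(y - x) := by ring
      rw [this]
      refine (Padic.nonarchimedean _ _).trans (max_le h1 ?_)
      rwa [norm_neg]
    · intro h1
      have : y - (r : ℚ_[p]) = (x - r) + (y - x) := by ring
      rw [this]
      exact (Padic.nonarchimedean _ _).trans (max_le h1 h)
  rw [key]

lemma pFract_zero (p : ℕ) [hp : Fact p.Prime] : pFract p 0 = 0 := by
  have h := Classical.epsilon_spec_aux (α := ℚ) ⟨0⟩ (fun r : ℚ =>
    0 ≤ r ∧ r < 1 ∧ (∃ m k : ℕ, r = (m : ℚ) / (p : ℚ) ^ k) ∧ ‖(0 : ℚ_[p]) - (r : ℚ_[p])‖ ≤ 1)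
    ⟨0, le_rfl, one_pos, ⟨0, 0, by simp⟩, by simp⟩
  change 0 ≤ pFract p 0 ∧ pFract p 0 < 1 ∧ (∃ m k : ℕ, pFract p 0 = (m : ℚ) / (p : ℚ) ^ k) ∧
    ‖(0 : ℚ_[p]) - (pFract p 0 : ℚ_[p])‖ ≤ 1 at h
  obtain ⟨h0, h1, ⟨m, k, hmk⟩, hn⟩ := h
  have hp0 : (p : ℚ) ≠ 0 := by exact_mod_cast hp.out.ne_zero
  have hpk : (0 : ℚ) < (p : ℚ) ^ k := by have := hp.out.pos; positivity
  have hm : ((m : ℤ) : ℚ_[p]) = (pFract p 0 : ℚ_[p]) * (p : ℚ_[p]) ^ k := by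
    have : (m : ℚ) = pFract p 0 * (p : ℚ) ^ k := by rw [hmk]; field_simp
    have := congrArg (fun q : ℚ => (q : ℚ_[p])) this
    push_cast at this ⊢
    exact this
  have hd : ((p ^ k : ℕ) : ℤ) ∣ (m : ℤ) := by
    have := (Padic.norm_int_le_pow_iff_dvd (p := p) (m : ℤ) k).1 (by
      rw [hm, norm_mul, Padic.norm_p_pow]
      rw [zero_sub, norm_neg] at hn
      exact mul_le_of_le_one_left (by positivity) hn)
    exact_mod_cast this
  have hlt : m < p ^ k := by
    have : (m : ℚ) < (p : ℚ) ^ k := by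
      rw [hmk, div_lt_one hpk] at h1; exact h1
    exact_mod_cast this
  have : m = 0 := Nat.eq_zero_of_dvd_of_lt (by exact_mod_cast hd) hlt
  rw [hmk, this]; simp

lemma padicChar_eq_one (p : ℕ) [Fact p.Prime] (x : ℚ_[p]) (h : ‖x‖ ≤ 1) : padicChar p x = 1 := by
  unfold padicChar
  rw [pFract_congr p 0 x (by simpa using h), pFract_zero]
  simp

lemma norm_padicChar (p : ℕ) [Fact p.Prime] (x : ℚ_[p]) : ‖padicChar p x‖ = 1 := by
  unfold padicChar
  have : (2 * Real.pi * Complex.I * ((pFract p x : ℚ) : ℂ))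
      = ((2 * Real.pi * (pFract p x : ℝ) : ℝ) : ℂ) * Complex.I := by push_cast; ring
  rw [this, Complex.norm_exp_ofReal_mul_I]

lemma continuous_padicChar (p : ℕ) [Fact p.Prime] : Continuous (padicChar p) := by
  apply IsLocallyConstant.continuous
  rw [IsLocallyConstant.iff_eventually_eq]
  intro x
  filter_upwards [Metric.closedBall_mem_nhds x one_pos] with y hy
  unfold padicChar
  rw [pFract_congr p x y (by simpa [dist_eq_norm] using hy)]

lemma exists_pnorm_eq (p : ℕ) [Fact p.Prime] (n : ℕ) (x : Fin n → ℚ_[p]) (hx : 0 < ‖x‖) :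
    ∃ j : ℤ, ‖x‖ = (p : ℝ) ^ j := by
  have hne : Nonempty (Fin n) := by
    by_contra h
    rw [not_nonempty_iff] at h
    rw [Subsingleton.elim x 0, norm_zero] at hx
    exact lt_irrefl _ hx
  obtain ⟨i, hi⟩ := Finite.exists_max (fun i => ‖x i‖)
  have h : ‖x‖ = ‖x i‖ :=
    le_antisymm ((pi_norm_le_iff_of_nonneg (norm_nonneg _)).2 hi) (norm_le_pi_norm x i)
  have hxi : x i ≠ 0 := by
    intro h0; rw [h, h0, norm_zero] at hx; exact lt_irrefl _ hx
  exact ⟨_, h.trans (Padic.norm_eq_zpow_neg_valuation hxi)⟩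

lemma measurableSet_pball (p : ℕ) [Fact p.Prime] (n : ℕ)
    [MeasurableSpace (Fin n → ℚ_[p])] [BorelSpace (Fin n → ℚ_[p])] (r : ℝ) :
    MeasurableSet {x : Fin n → ℚ_[p] | ‖x‖ ≤ r} :=
  (isClosed_le continuous_norm continuous_const).measurableSet

lemma measurableSet_psphere (p : ℕ) [Fact p.Prime] (n : ℕ)
    [MeasurableSpace (Fin n → ℚ_[p])] [BorelSpace (Fin n → ℚ_[p])] (r : ℝ) :
    MeasurableSet {x : Fin n → ℚ_[p] | ‖x‖ = r} :=
  (isClosed_eq continuous_norm continuous_const).measurableSet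

lemma exists_digit (p : ℕ) [Fact p.Prime] (j : ℤ) (y : ℚ_[p]) (hy : ‖y‖ ≤ (p : ℝ) ^ (j + 1)) :
    ∃ d : Fin p, ‖y - (p : ℚ_[p]) ^ (-(j + 1)) * ((d : ℕ) : ℚ_[p])‖ ≤ (p : ℝ) ^ j := by
  have hp := (Fact.out : p.Prime)
  have hpR : (0 : ℝ) < p := by exact_mod_cast hp.pos
  have hp0 : (p : ℚ_[p]) ≠ 0 := by exact_mod_cast hp.ne_zero
  have hz : ‖(p : ℚ_[p]) ^ (j + 1) * y‖ ≤ 1 := by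
    rw [norm_mul, Padic.norm_p_zpow, zpow_neg]
    rw [inv_mul_le_one₀ (by positivity)]
    exact hy
  let z : ℤ_[p] := ⟨(p : ℚ_[p]) ^ (j + 1) * y, hz⟩
  refine ⟨⟨z.zmodRepr, z.zmodRepr_lt_p⟩, ?_⟩
  have h1 : ‖(p : ℚ_[p]) ^ (j + 1) * y - (z.zmodRepr : ℚ_[p])‖ < 1 := by
    have := z.norm_sub_zmodRepr_lt_one
    rw [PadicInt.norm_def] at this
    push_cast at this
    exact this
  have h2 : y - (p : ℚ_[p]) ^ (-(j + 1)) * (z.zmodRepr : ℚ_[p])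
      = (p : ℚ_[p]) ^ (-(j + 1)) * ((p : ℚ_[p]) ^ (j + 1) * y - (z.zmodRepr : ℚ_[p])) := by
    rw [mul_sub, ← mul_assoc, ← zpow_add₀ hp0]; simp
  rw [Padic.norm_le_pow_iff_norm_lt_pow_add_one]
  simp only
  rw [h2, norm_mul, Padic.norm_p_zpow, neg_neg]
  exact mul_lt_of_lt_one_right (by positivity) h1

lemma digit_unique (p : ℕ) [Fact p.Prime] (j : ℤ) (y : ℚ_[p]) (d e : Fin p)
    (hd : ‖y - (p : ℚ_[p]) ^ (-(j + 1)) * ((d : ℕ) : ℚ_[p])‖ ≤ (p : ℝ) ^ j)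
    (he : ‖y - (p : ℚ_[p]) ^ (-(j + 1)) * ((e : ℕ) : ℚ_[p])‖ ≤ (p : ℝ) ^ j) : d = e := by
  have hp := (Fact.out : p.Prime)
  have hpR : (0 : ℝ) < p := by exact_mod_cast hp.pos
  have h1 : ‖(p : ℚ_[p]) ^ (-(j + 1)) * ((((d : ℕ) : ℤ) - ((e : ℕ) : ℤ) : ℤ) : ℚ_[p])‖
      ≤ (p : ℝ) ^ j := by
    have : (p : ℚ_[p]) ^ (-(j + 1)) * ((((d : ℕ) : ℤ) - ((e : ℕ) : ℤ) : ℤ) : ℚ_[p])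
      = (y - (p : ℚ_[p]) ^ (-(j + 1)) * ((e : ℕ) : ℚ_[p])) +
        -(y - (p : ℚ_[p]) ^ (-(j + 1)) * ((d : ℕ) : ℚ_[p])) := by push_cast; ring
    rw [this]
    exact (Padic.nonarchimedean _ _).trans (max_le he (by rwa [norm_neg]))
  rw [Padic.norm_le_pow_iff_norm_lt_pow_add_one, norm_mul, Padic.norm_p_zpow, neg_neg] at h1
  have h2 : ‖((((d : ℕ) : ℤ) - ((e : ℕ) : ℤ) : ℤ) : ℚ_[p])‖ < 1 := by
    have hpos : (0 : ℝ) < (p : ℝ) ^ (j + 1) := by positivity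
    by_contra hc
    push Not at hc
    nlinarith
  rw [Padic.norm_intCast_lt_one_iff] at h2
  have h3 := Int.eq_zero_of_abs_lt_dvd h2 (by
    have := d.2; have := e.2
    rw [abs_lt]; constructor <;> omega)
  ext; omega

lemma measure_pball_succ (p : ℕ) [Fact p.Prime] (n : ℕ)
    [MeasurableSpace (Fin n → ℚ_[p])] [BorelSpace (Fin n → ℚ_[p])]
    (μ : Measure (Fin n → ℚ_[p])) [μ.IsAddHaarMeasure] (j : ℤ) :
    μ {x : Fin n → ℚ_[p] | ‖x‖ ≤ (p : ℝ) ^ (j + 1)}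
      = (p : ℝ≥0∞) ^ n * μ {x : Fin n → ℚ_[p] | ‖x‖ ≤ (p : ℝ) ^ j} := by
  have hp := (Fact.out : p.Prime)
  have hpR : (0 : ℝ) < p := by exact_mod_cast hp.pos
  have hp1 : (1 : ℝ) ≤ p := by exact_mod_cast hp.one_le
  let c : (Fin n → Fin p) → (Fin n → ℚ_[p]) :=
    fun f i => (p : ℚ_[p]) ^ (-(j + 1)) * (((f i : Fin p) : ℕ) : ℚ_[p])
  let T : (Fin n → Fin p) → Set (Fin n → ℚ_[p]) := fun f =>
    (fun x => x + -c f) ⁻¹' {x : Fin n → ℚ_[p] | ‖x‖ ≤ (p : ℝ) ^ j}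
  have hmem : ∀ f x, x ∈ T f ↔ ∀ i, ‖x i - (p : ℚ_[p]) ^ (-(j + 1)) *
      (((f i : Fin p) : ℕ) : ℚ_[p])‖ ≤ (p : ℝ) ^ j := by
    intro f x
    simp only [T, c, Set.mem_preimage, Set.mem_ofPred_eq]
    rw [pi_norm_le_iff_of_nonneg (by positivity)]
    simp [sub_eq_add_neg]
  have hU : {x : Fin n → ℚ_[p] | ‖x‖ ≤ (p : ℝ) ^ (j + 1)} = ⋃ f, T f := by
    ext x
    simp only [Set.mem_iUnion, hmem, Set.mem_ofPred_eq]
    rw [pi_norm_le_iff_of_nonneg (by positivity)]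
    constructor
    · intro h
      choose f hf using fun i => exists_digit p j (x i) (h i)
      exact ⟨f, hf⟩
    · rintro ⟨f, hf⟩ i
      have : x i = (x i - (p : ℚ_[p]) ^ (-(j + 1)) * (((f i : Fin p) : ℕ) : ℚ_[p])) +
        (p : ℚ_[p]) ^ (-(j + 1)) * (((f i : Fin p) : ℕ) : ℚ_[p]) := by ring
      rw [this]
      refine (Padic.nonarchimedean _ _).trans (max_le ((hf i).trans ?_) ?_)
      · exact zpow_le_zpow_right₀ hp1 (by omega)
      · rw [norm_mul, Padic.norm_p_zpow, neg_neg]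
        refine mul_le_of_le_one_right (by positivity) ?_
        exact_mod_cast Padic.norm_int_le_one (p := p) ((f i : Fin p) : ℕ)
  have hd : Pairwise (Function.onFun Disjoint T) := by
    intro f g hfg
    rw [Function.onFun, Set.disjoint_left]
    intro x hf hg
    rw [hmem] at hf hg
    exact hfg (funext fun i => digit_unique p j (x i) _ _ (hf i) (hg i))
  have hm : ∀ f, MeasurableSet (T f) := fun f =>
    (measurableSet_pball p n _).preimage (measurable_add_const _)
  rw [hU, measure_iUnion hd hm, tsum_fintype]
  simp only [T, measure_preimage_add_right]
  simp

lemma measure_pball (p : ℕ) [Fact p.Prime] (n : ℕ)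
    [MeasurableSpace (Fin n → ℚ_[p])] [BorelSpace (Fin n → ℚ_[p])]
    (μ : Measure (Fin n → ℚ_[p])) [μ.IsAddHaarMeasure]
    (hμ : μ {x : Fin n → ℚ_[p] | ‖x‖ ≤ 1} = 1) (j : ℤ) :
    μ {x : Fin n → ℚ_[p] | ‖x‖ ≤ (p : ℝ) ^ j} = (p : ℝ≥0∞) ^ (j * (n : ℤ)) := by
  have hp := (Fact.out : p.Prime)
  have hp0 : (p : ℝ≥0∞) ≠ 0 := by exact_mod_cast hp.ne_zero
  have hpt : (p : ℝ≥0∞) ≠ ∞ := ENNReal.natCast_ne_top p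
  induction j using Int.induction_on with
  | zero => simpa using hμ
  | succ i ih =>
    rw [measure_pball_succ, ih, add_mul, one_mul, ENNReal.zpow_add hp0 hpt, zpow_natCast, mul_comm]
  | pred i ih =>
    have h := measure_pball_succ p n μ (-(i : ℤ) - 1)
    rw [sub_add_cancel, ih] at h
    have h2 : -(i : ℤ) * n = (n : ℤ) + (-(i : ℤ) - 1) * n := by ring
    rw [h2, ENNReal.zpow_add hp0 hpt, zpow_natCast] at h
    exact ((ENNReal.mul_right_inj (pow_ne_zero _ hp0) (ENNReal.pow_ne_top hpt)).1 h).symm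

lemma measure_psphere (p : ℕ) [Fact p.Prime] (n : ℕ) (hn : 0 < n)
    [MeasurableSpace (Fin n → ℚ_[p])] [BorelSpace (Fin n → ℚ_[p])]
    (μ : Measure (Fin n → ℚ_[p])) [μ.IsAddHaarMeasure]
    (hμ : μ {x : Fin n → ℚ_[p] | ‖x‖ ≤ 1} = 1) (j : ℤ) :
    2⁻¹ * (p : ℝ≥0∞) ^ (j * (n : ℤ)) ≤ μ {x : Fin n → ℚ_[p] | ‖x‖ = (p : ℝ) ^ j} := by
  have hp := (Fact.out : p.Prime)
  have hpR : (1 : ℝ) < p := by exact_mod_cast hp.one_lt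
  have hp0 : (p : ℝ≥0∞) ≠ 0 := by exact_mod_cast hp.ne_zero
  have hpt : (p : ℝ≥0∞) ≠ ∞ := ENNReal.natCast_ne_top p
  set s := μ {x : Fin n → ℚ_[p] | ‖x‖ = (p : ℝ) ^ j} with hs
  set b := μ {x : Fin n → ℚ_[p] | ‖x‖ ≤ (p : ℝ) ^ (j - 1)} with hb
  have hB : μ {x : Fin n → ℚ_[p] | ‖x‖ ≤ (p : ℝ) ^ j} = (p : ℝ≥0∞) ^ n * b := by
    have := measure_pball_succ p n μ (j - 1)
    rwa [sub_add_cancel] at this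
  have hbt : b ≠ ∞ := by
    rw [hb, measure_pball p n μ hμ]
    exact (ENNReal.zpow_lt_top hp0 hpt _).ne
  have hsub : (p : ℝ≥0∞) ^ n * b ≤ b + s := by
    rw [← hB]
    refine (measure_mono ?_).trans (measure_union_le _ _)
    intro x hx
    rcases (norm_nonneg x).eq_or_lt with h0 | h0
    · left; simp only [Set.mem_ofPred_eq]; rw [← h0]; positivity
    · obtain ⟨k, hk⟩ := exists_pnorm_eq p n x h0
      simp only [Set.mem_ofPred_eq, Set.mem_union, hk] at hx ⊢
      rw [zpow_le_zpow_iff_right₀ hpR] at hx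
      rw [zpow_le_zpow_iff_right₀ hpR, zpow_right_inj₀ (by linarith) hpR.ne']
      omega
  rw [← measure_pball p n μ hμ, hB]
  have h2 : 2 * b ≤ (p : ℝ≥0∞) ^ n * b := by
    gcongr
    have : 2 ≤ p ^ n := hp.two_le.trans (Nat.le_self_pow hn.ne' p)
    exact_mod_cast this
  have hbs : b ≤ s := by
    have := h2.trans hsub
    rw [two_mul] at this
    exact (ENNReal.add_le_add_iff_left hbt).1 this
  calc 2⁻¹ * ((p : ℝ≥0∞) ^ n * b) ≤ 2⁻¹ * (s + s) := by gcongr; exact hsub.trans (by gcongr)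
    _ = s := by rw [← two_mul, ← mul_assoc, ENNReal.inv_mul_cancel (by simp) (by simp), one_mul]

lemma one_sub_fourier_le (p : ℕ) [Fact p.Prime] (n : ℕ)
    [MeasurableSpace (Fin n → ℚ_[p])] [BorelSpace (Fin n → ℚ_[p])]
    (μ : Measure (Fin n → ℚ_[p])) [μ.IsAddHaarMeasure]
    (hμ : μ {x : Fin n → ℚ_[p] | ‖x‖ ≤ 1} = 1)
    (a : (Fin n → ℚ_[p]) → ℝ) (ha_nonneg : ∀ x, 0 ≤ a x)
    (ha_int : Integrable a μ)
    (ha_one : ∫ x, a x ∂μ = 1)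
    (A : ℤ → ℝ≥0∞)
    (hA : ∀ j : ℤ, A j = ⨆ x ∈ {x : Fin n → ℚ_[p] | ‖x‖ = (p : ℝ) ^ j}, ENNReal.ofReal (a x))
    (N : ℤ) (ξ : Fin n → ℚ_[p]) (hξ : ‖ξ‖ ≤ (p : ℝ) ^ (-N)) :
    ENNReal.ofReal (1 - (∫ x, padicChar p (∑ i, ξ i * x i) * (a x : ℂ) ∂μ).re)
      ≤ 2 * ∑' k : ℕ, (p : ℝ≥0∞) ^ ((N + 1 + k) * (n : ℤ)) * A (N + 1 + k) := by
  have hp := (Fact.out : p.Prime)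
  have hpR : (1 : ℝ) < p := by exact_mod_cast hp.one_lt
  have hp0 : (0 : ℝ) < p := by linarith
  let S : ℕ → Set (Fin n → ℚ_[p]) := fun k => {x | ‖x‖ = (p : ℝ) ^ (N + 1 + k)}
  have hcont : Continuous fun x : Fin n → ℚ_[p] => padicChar p (∑ i, ξ i * x i) :=
    (continuous_padicChar p).comp (by fun_prop)
  have hint : Integrable (fun x => padicChar p (∑ i, ξ i * x i) * (a x : ℂ)) μ := by
    refine ha_int.ofReal.bdd_mul (c := 1) hcont.aestronglyMeasurable ?_
    exact Filter.Eventually.of_forall fun x => (norm_padicChar p _).le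
  have hre : (∫ x, padicChar p (∑ i, ξ i * x i) * (a x : ℂ) ∂μ).re
      = ∫ x, (padicChar p (∑ i, ξ i * x i)).re * a x ∂μ := by
    have := integral_re hint
    simp only [RCLike.re_eq_complex_re, Complex.re_mul_ofReal] at this
    exact this.symm
  have hint2 : Integrable (fun x => (padicChar p (∑ i, ξ i * x i)).re * a x) μ := by
    have := hint.re
    simpa only [RCLike.re_eq_complex_re, Complex.re_mul_ofReal] using this
  have hone : ∀ x : Fin n → ℚ_[p], ‖x‖ ≤ (p : ℝ) ^ N → padicChar p (∑ i, ξ i * x i) = 1 := by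
    intro x hx
    apply padicChar_eq_one
    refine IsUltrametricDist.norm_sum_le_of_forall_le_of_nonneg zero_le_one fun i _ => ?_
    rw [norm_mul]
    calc ‖ξ i‖ * ‖x i‖ ≤ (p : ℝ) ^ (-N) * (p : ℝ) ^ N := by
          gcongr
          · exact (norm_le_pi_norm ξ i).trans hξ
          · exact (norm_le_pi_norm x i).trans hx
      _ = 1 := by rw [← zpow_add₀ hp0.ne']; simp
  have hreb : ∀ y : ℚ_[p], |(padicChar p y).re| ≤ 1 := fun y =>
    (Complex.abs_re_le_norm _).trans (norm_padicChar p y).le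
  have hint3 : Integrable (fun x => a x - (padicChar p (∑ i, ξ i * x i)).re * a x) μ :=
    ha_int.sub hint2
  rw [hre, ← ha_one, ← integral_sub ha_int hint2, ofReal_integral_eq_lintegral_ofReal
    hint3 (Filter.Eventually.of_forall fun x => by
      have := (abs_le.1 (hreb (∑ i, ξ i * x i))).2
      have := ha_nonneg x
      simp only [Pi.zero_apply]
      nlinarith)]
  have hSm : ∀ k, MeasurableSet (S k) := fun k => measurableSet_psphere p n _
  calc ∫⁻ x, ENNReal.ofReal (a x - (padicChar p (∑ i, ξ i * x i)).re * a x) ∂μ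
      ≤ ∫⁻ x, ∑' k, (S k).indicator (fun _ => 2 * A (N + 1 + k)) x ∂μ := by
        refine lintegral_mono fun x => ?_
        rcases le_or_gt ‖x‖ ((p : ℝ) ^ N) with h | h
        · simp [hone x h]
        · obtain ⟨j, hj⟩ := exists_pnorm_eq p n x (lt_trans (by positivity) h)
          rw [hj, zpow_lt_zpow_iff_right₀ hpR] at h
          obtain ⟨k, rfl⟩ : ∃ k : ℕ, j = N + 1 + k := ⟨(j - N - 1).toNat, by omega⟩
          refine le_trans ?_ (ENNReal.le_tsum k)
          have hxS : x ∈ S k := hj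
          rw [Set.indicator_of_mem hxS]
          have h1 : ENNReal.ofReal (a x) ≤ A (N + 1 + k) := by
            rw [hA]
            exact le_iSup₂_of_le x hj le_rfl
          calc _ ≤ ENNReal.ofReal (2 * a x) := by
                apply ENNReal.ofReal_le_ofReal
                have := (abs_le.1 (hreb (∑ i, ξ i * x i))).1
                have := ha_nonneg x
                nlinarith
            _ = 2 * ENNReal.ofReal (a x) := by
                rw [ENNReal.ofReal_mul (by norm_num)]; simp
            _ ≤ _ := by gcongr
    _ = ∑' k : ℕ, 2 * A (N + 1 + k) * μ (S k) := by
        rw [lintegral_tsum fun k => (measurable_const.indicator (hSm k)).aemeasurable]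
        congr 1; funext k
        rw [lintegral_indicator_const (hSm k)]
    _ ≤ ∑' k : ℕ, 2 * ((p : ℝ≥0∞) ^ ((N + 1 + k) * (n : ℤ)) * A (N + 1 + k)) := by
        refine ENNReal.tsum_le_tsum fun k => ?_
        rw [mul_assoc, mul_comm (A _)]
        gcongr
        rw [← measure_pball p n μ hμ]
        exact measure_mono fun x hx => le_of_eq hx
    _ = _ := ENNReal.tsum_mul_left

/-- If `∑_{N=l}^∞ [p^{Nn} ∑_{j=N+1}^∞ p^{jn} A_j]⁻¹ = ∞` for some `l ≥ 0`, then
`∫_{‖ξ‖ ≤ p^{-l}} (1 - â(ξ))⁻¹ d^n ξ = ∞`, where `A_j = sup_{‖x‖=p^j} a(x)` and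
`â` is the Fourier transform of the nonnegative even probability density `a`. -/
theorem padic_divergence_criterion (p : ℕ) [Fact p.Prime] (n : ℕ) (hn : 0 < n)
    [MeasurableSpace (Fin n → ℚ_[p])] [BorelSpace (Fin n → ℚ_[p])]
    (μ : Measure (Fin n → ℚ_[p])) [μ.IsAddHaarMeasure]
    (hμ : μ {x : Fin n → ℚ_[p] | ‖x‖ ≤ 1} = 1)
    (a : (Fin n → ℚ_[p]) → ℝ) (ha_nonneg : ∀ x, 0 ≤ a x)
    (ha_even : ∀ x, a (-x) = a x) (ha_int : Integrable a μ)
    (ha_one : ∫ x, a x ∂μ = 1)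
    (A : ℤ → ℝ≥0∞)
    (hA : ∀ j : ℤ, A j = ⨆ x ∈ {x : Fin n → ℚ_[p] | ‖x‖ = (p : ℝ) ^ j}, ENNReal.ofReal (a x))
    (l : ℕ)
    (hdiv : ∑' N : ℕ,
        ((p : ℝ≥0∞) ^ (((l : ℤ) + N) * (n : ℤ)) *
          ∑' k : ℕ, (p : ℝ≥0∞) ^ (((l : ℤ) + N + 1 + k) * (n : ℤ)) * A ((l : ℤ) + N + 1 + k))⁻¹
        = ∞) :
    ∫⁻ ξ in {ξ : Fin n → ℚ_[p] | ‖ξ‖ ≤ (p : ℝ) ^ (-(l : ℤ))},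
        (ENNReal.ofReal (1 - (∫ x, padicChar p (∑ i, ξ i * x i) * (a x : ℂ) ∂μ).re))⁻¹ ∂μ
      = ∞ := by
  have hp := (Fact.out : p.Prime)
  have hpR : (1 : ℝ) < p := by exact_mod_cast hp.one_lt
  have hp0 : (p : ℝ≥0∞) ≠ 0 := by exact_mod_cast hp.ne_zero
  have hpt : (p : ℝ≥0∞) ≠ ∞ := ENNReal.natCast_ne_top p
  let R : ℕ → Set (Fin n → ℚ_[p]) := fun N => {x | ‖x‖ = (p : ℝ) ^ (-((l : ℤ) + N))}
  have hRm : ∀ N, MeasurableSet (R N) := fun N => measurableSet_psphere p n _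
  have hRd : Pairwise (Function.onFun Disjoint R) := by
    intro M N hMN
    rw [Function.onFun, Set.disjoint_left]
    intro x hM hN
    have h : (p : ℝ) ^ (-((l : ℤ) + M)) = (p : ℝ) ^ (-((l : ℤ) + N)) := Eq.trans (Eq.symm hM) hN
    rw [zpow_right_inj₀ (by linarith) hpR.ne'] at h
    omega
  rw [eq_top_iff]
  calc ∞ = 4⁻¹ * ∞ := by rw [ENNReal.mul_top (by simp)]
    _ = ∑' N : ℕ, 4⁻¹ * ((p : ℝ≥0∞) ^ (((l : ℤ) + N) * (n : ℤ)) *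
          ∑' k : ℕ, (p : ℝ≥0∞) ^ (((l : ℤ) + N + 1 + k) * (n : ℤ)) *
            A ((l : ℤ) + N + 1 + k))⁻¹ := by
        rw [ENNReal.tsum_mul_left, hdiv]
    _ ≤ ∑' N : ℕ, ∫⁻ ξ in R N, (ENNReal.ofReal
          (1 - (∫ x, padicChar p (∑ i, ξ i * x i) * (a x : ℂ) ∂μ).re))⁻¹ ∂μ := by
        refine ENNReal.tsum_le_tsum fun N => ?_
        set s := ∑' k : ℕ, (p : ℝ≥0∞) ^ (((l : ℤ) + N + 1 + k) * (n : ℤ)) *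
            A ((l : ℤ) + N + 1 + k) with hs
        have hz0 : (p : ℝ≥0∞) ^ (((l : ℤ) + N) * (n : ℤ)) ≠ 0 :=
          (ENNReal.zpow_pos hp0 hpt _).ne'
        have hzt : (p : ℝ≥0∞) ^ (((l : ℤ) + N) * (n : ℤ)) ≠ ∞ :=
          (ENNReal.zpow_lt_top hp0 hpt _).ne
        calc _ = (2 * s)⁻¹ * (2⁻¹ * (p : ℝ≥0∞) ^ (-((l : ℤ) + N) * (n : ℤ))) := by
              rw [ENNReal.mul_inv (Or.inl hz0) (Or.inl hzt),
                ENNReal.mul_inv (Or.inl (by simp)) (Or.inl (by simp)), neg_mul,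
                ENNReal.zpow_neg]
              have : (4 : ℝ≥0∞)⁻¹ = 2⁻¹ * 2⁻¹ := by
                rw [← ENNReal.mul_inv (by simp) (by simp)]; norm_num
              rw [this]
              ring
          _ ≤ (2 * s)⁻¹ * μ (R N) := by
              gcongr
              exact measure_psphere p n hn μ hμ _
          _ = ∫⁻ ξ in R N, (2 * s)⁻¹ ∂μ := by rw [setLIntegral_const]
          _ ≤ _ := by
              refine setLIntegral_mono' (hRm N) fun ξ hξ => ?_
              rw [ENNReal.inv_le_inv]
              exact one_sub_fourier_le p n μ hμ a ha_nonneg ha_int ha_one A hA _ ξ (le_of_eq hξ)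
    _ = ∫⁻ ξ in ⋃ N, R N, (ENNReal.ofReal
          (1 - (∫ x, padicChar p (∑ i, ξ i * x i) * (a x : ℂ) ∂μ).re))⁻¹ ∂μ :=
        (lintegral_iUnion hRm hRd _).symm
    _ ≤ _ := by
        refine lintegral_mono_set (Set.iUnion_subset fun N x hx => ?_)
        refine (le_of_eq hx).trans (zpow_le_zpow_right₀ hpR.le (by omega))
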